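/- Let f be a smooth function on an open neighborhood U of 0 in ℝⁿ. For ℓ ∈ ℕ set f^[ℓ](x) = Σ_{α : ⟨α⟩ = ℓ} (1/α!) ∂^α f(0) x^α (a polynomial homogeneous of degree ℓ with respect to the anisotropic dilations). Then for every N ∈ ℕ, f∘δ_t − Σ_{ℓ < N} t^ℓ f^[ℓ] = O(t^N) in C^∞(U) as t → 0. -/

import Mathlib

open scoped BigOperators
open Filter Topology

namespace Carnot

/-- Anisotropic dilation `t · x = (t^{w_1} x_1, …, t^{w_n} x_n)`. -/
def dil {n : ℕ} (w : Fin n → ℕ) (t : ℝ) (x : Fin n → ℝ) : Fin n → ℝ :=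
  fun i => t ^ (w i) * x i

/-- Weighted length `⟨α⟩` of a multi-index. -/
def wlen {n : ℕ} (w : Fin n → ℕ) (α : Fin n → ℕ) : ℕ := ∑ i, w i * α i

/-- Length `|α|` of a multi-index. -/
def mlen {n : ℕ} (α : Fin n → ℕ) : ℕ := ∑ i, α i

/-- A vector field acting on a function: `(Xf)(x) = Df(x)[X(x)]`. -/
noncomputable def vf {n : ℕ} (X : (Fin n → ℝ) → (Fin n → ℝ)) (f : (Fin n → ℝ) → ℝ) :
    (Fin n → ℝ) → ℝ :=
  fun x => fderiv ℝ f x (X x)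

/-- Iterated action `X_I f = X_{i_1}(X_{i_2}(⋯(X_{i_k} f)))`. -/
noncomputable def vfSeq {n : ℕ} (X : Fin n → (Fin n → ℝ) → (Fin n → ℝ)) :
    List (Fin n) → ((Fin n → ℝ) → ℝ) → ((Fin n → ℝ) → ℝ)
  | [], f => f
  | i :: I, f => vf (X i) (vfSeq X I f)

/-- Weight `⟨I⟩` of a finite sequence of indices. -/
def seqW {n : ℕ} (w : Fin n → ℕ) (I : List (Fin n)) : ℕ := (I.map w).sum

/-- The list `(1,…,1,2,…,2,…,n,…,n)` with `i` repeated `α i` times. -/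
def multiList {n : ℕ} (α : Fin n → ℕ) : List (Fin n) :=
  (List.finRange n).flatMap fun i => List.replicate (α i) i

/-- `X^α f = X_1^{α_1} ⋯ X_n^{α_n} f`. -/
noncomputable def vfPow {n : ℕ} (X : Fin n → (Fin n → ℝ) → (Fin n → ℝ)) (α : Fin n → ℕ)
    (f : (Fin n → ℝ) → ℝ) : (Fin n → ℝ) → ℝ :=
  vfSeq X (multiList α) f

/-- Partial derivative `∂^α f`. -/
noncomputable def pdPow {n : ℕ} (α : Fin n → ℕ) (f : (Fin n → ℝ) → ℝ) : (Fin n → ℝ) → ℝ :=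
  vfPow (fun i => fun _ => Pi.single i (1 : ℝ)) α f

/-- Lie bracket of two vector fields. -/
noncomputable def lieBk {n : ℕ} (X Y : (Fin n → ℝ) → (Fin n → ℝ)) : (Fin n → ℝ) → (Fin n → ℝ) :=
  fun x => fderiv ℝ Y x (X x) - fderiv ℝ X x (Y x)

/-- A weight sequence: non-decreasing, positive, starting at `1`. -/
structure IsWeight {n : ℕ} (w : Fin n → ℕ) : Prop where
  mono : Monotone w
  pos : ∀ i, 0 < w i
  first : ∀ h : 0 < n, w ⟨0, h⟩ = 1

/-- An `H`-frame on `V`. -/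
structure IsHFrame {n : ℕ} (w : Fin n → ℕ) (X : Fin n → (Fin n → ℝ) → (Fin n → ℝ))
    (V : Set (Fin n → ℝ)) : Prop where
  smooth : ∀ j, ContDiffOn ℝ (⊤ : ℕ∞) (X j) V
  basis : ∀ x ∈ V, LinearIndependent ℝ fun j => X j x
  bracket : ∃ L : Fin n → Fin n → Fin n → (Fin n → ℝ) → ℝ,
    (∀ i j k, ContDiffOn ℝ (⊤ : ℕ∞) (L i j k) V) ∧
    (∀ i j k, ¬ w k ≤ w i + w j → ∀ x ∈ V, L i j k x = 0) ∧
    ∀ i j, ∀ x ∈ V, lieBk (X i) (X j) x = ∑ k, L i j k x • X k x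

/-- `f` has order `≥ N` at `a` with respect to the frame `X`. -/
def OrderGe {n : ℕ} (w : Fin n → ℕ) (X : Fin n → (Fin n → ℝ) → (Fin n → ℝ))
    (f : (Fin n → ℝ) → ℝ) (a : Fin n → ℝ) (N : ℕ) : Prop :=
  ∀ I : List (Fin n), seqW w I < N → vfSeq X I f a = 0

/-- `f` has order exactly `N` at `a` with respect to the frame `X`. -/
def OrderEq {n : ℕ} (w : Fin n → ℕ) (X : Fin n → (Fin n → ℝ) → (Fin n → ℝ))
    (f : (Fin n → ℝ) → ℝ) (a : Fin n → ℝ) (N : ℕ) : Prop :=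
  OrderGe w X f a N ∧ ∃ I : List (Fin n), seqW w I = N ∧ vfSeq X I f a ≠ 0

/-- `f` has weight `≥ N`. -/
def WeightGe {n : ℕ} (w : Fin n → ℕ) (f : (Fin n → ℝ) → ℝ) (N : ℤ) : Prop :=
  ∀ α : Fin n → ℕ, (wlen w α : ℤ) < N → pdPow α f 0 = 0

/-- `f` has weight exactly `N`. -/
def WeightEq {n : ℕ} (w : Fin n → ℕ) (f : (Fin n → ℝ) → ℝ) (N : ℤ) : Prop :=
  WeightGe w f N ∧ ∃ α : Fin n → ℕ, (wlen w α : ℤ) = N ∧ pdPow α f 0 ≠ 0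

/-- A pseudo-norm for the anisotropic dilations. -/
structure IsPseudoNorm {n : ℕ} (w : Fin n → ℕ) (ρ : (Fin n → ℝ) → ℝ) : Prop where
  cont : Continuous ρ
  nonneg : ∀ x, 0 ≤ ρ x
  pos : ∀ x, x ≠ 0 → 0 < ρ x
  homog : ∀ t x, ρ (dil w t x) = |t| * ρ x

/-- Multi-indices with all entries `< B`. -/
def mIdx (n B : ℕ) : Finset (Fin n → ℕ) := Fintype.piFinset fun _ => Finset.range B

/-- The monomial `x^α`. -/
def monom {n : ℕ} (α : Fin n → ℕ) (x : Fin n → ℝ) : ℝ := ∏ i, x i ^ α i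

/-- Taylor coefficient `(1/α!) ∂^α f(0)`. -/
noncomputable def taylorCoeff {n : ℕ} (α : Fin n → ℕ) (f : (Fin n → ℝ) → ℝ) : ℝ :=
  ((∏ i, Nat.factorial (α i) : ℕ) : ℝ)⁻¹ * pdPow α f 0

/-- The homogeneous part `f^[ℓ]` of degree `ℓ` of the Taylor series of `f` at `0`. -/
noncomputable def homPart {n : ℕ} (w : Fin n → ℕ) (f : (Fin n → ℝ) → ℝ) (ℓ : ℕ) :
    (Fin n → ℝ) → ℝ :=
  fun x => ∑ α ∈ (mIdx n (ℓ + 1)).filter (fun α => wlen w α = ℓ),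
    taylorCoeff α f * monom α x

/-- `u_t = O(t^m)` in `C^∞(U)` as `t → 0`. -/
def BigOC {n : ℕ} (U : Set (Fin n → ℝ)) (u : ℝ → (Fin n → ℝ) → ℝ) (m : ℤ) : Prop :=
  ∀ K : Set (Fin n → ℝ), K ⊆ U → IsCompact K → ∀ β : Fin n → ℕ,
    ∃ C : ℝ, ∀ᶠ t in 𝓝[≠] (0 : ℝ), ∀ x ∈ K, |pdPow β (u t) x| ≤ C * |t| ^ m

/-- Componentwise `O(t^m)` in `C^∞(U)` for families of vector fields. -/
def BigOCVF {n : ℕ} (U : Set (Fin n → ℝ)) (u : ℝ → (Fin n → ℝ) → Fin n → ℝ)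
    (m : ℤ) : Prop :=
  ∀ K : Set (Fin n → ℝ), K ⊆ U → IsCompact K → ∀ β : Fin n → ℕ, ∀ k : Fin n,
    ∃ C : ℝ, ∀ᶠ t in 𝓝[≠] (0 : ℝ), ∀ x ∈ K,
      |pdPow β (fun y => u t y k) x| ≤ C * |t| ^ m

/-- `Θ = O_w(‖x‖^{w+m})` near `x = 0`. -/
def IsOw {n : ℕ} (w : Fin n → ℕ) (ρ : (Fin n → ℝ) → ℝ)
    (Θ : (Fin n → ℝ) → (Fin n → ℝ)) (m : ℤ) : Prop :=
  ∀ k, ∃ C : ℝ, ∀ᶠ x in 𝓝 (0 : Fin n → ℝ), |Θ x k| ≤ C * ρ x ^ ((w k : ℤ) + m)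

/-- A `w`-homogeneous map. -/
def WHomog {n : ℕ} (w : Fin n → ℕ) (φ : (Fin n → ℝ) → (Fin n → ℝ)) : Prop :=
  ∀ t x, φ (dil w t x) = dil w t (φ x)

/-- A map whose components are polynomial functions. -/
def IsPolyMap {n : ℕ} (φ : (Fin n → ℝ) → (Fin n → ℝ)) : Prop :=
  ∀ k, ∃ p : MvPolynomial (Fin n) ℝ, ∀ x, φ x k = MvPolynomial.eval x p

/-- A vector field homogeneous of degree `m`: `δ_t^* Y = t^m Y` for `t ≠ 0`. -/
def VFHomog {n : ℕ} (w : Fin n → ℕ) (Y : (Fin n → ℝ) → (Fin n → ℝ)) (m : ℤ) : Prop :=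
  ∀ t : ℝ, t ≠ 0 → ∀ x k, (t : ℝ) ^ (-(w k : ℤ)) * Y (dil w t x) k = t ^ m * Y x k

/-- A vector field has weight `W`: each component `X_k` has weight `≥ W + w_k`,
with equality for some `k`. -/
def VFWeightEq {n : ℕ} (w : Fin n → ℕ) (X : (Fin n → ℝ) → (Fin n → ℝ)) (W : ℤ) :
    Prop :=
  (∀ k, ∀ α : Fin n → ℕ, (wlen w α : ℤ) < W + w k →
    pdPow α (fun y => X y k) 0 = 0) ∧
  ∃ k, ∃ α : Fin n → ℕ, (wlen w α : ℤ) = W + w k ∧ pdPow α (fun y => X y k) 0 ≠ 0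

/-- The homogeneous part `X^[ℓ]` of degree `ℓ` of a vector field. -/
noncomputable def vfPart {n : ℕ} (w : Fin n → ℕ) (X : (Fin n → ℝ) → (Fin n → ℝ)) (ℓ : ℤ) :
    (Fin n → ℝ) → Fin n → ℝ :=
  fun x k => ∑ α ∈ (mIdx n ((ℓ + w k).toNat + 1)).filter
      (fun α => (wlen w α : ℤ) = ℓ + w k),
    taylorCoeff α (fun y => X y k) * monom α x

/-- `φ` produces privileged coordinates at `a` adapted to the `H`-frame `X`:
it is linearly adapted at `a` and each component has order `w_k` at `a`. -/
def PrivilegedAt {n : ℕ} (w : Fin n → ℕ) (X : Fin n → (Fin n → ℝ) → (Fin n → ℝ))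
    (a : Fin n → ℝ) (φ : (Fin n → ℝ) → (Fin n → ℝ)) : Prop :=
  (∀ j, fderiv ℝ φ a (X j a) = Pi.single j 1) ∧
  ∀ k, OrderEq w X (fun x => φ x k) a (w k)


/-- The frame of constant coordinate vector fields. -/
abbrev coordFrame (n : ℕ) : Fin n → (Fin n → ℝ) → (Fin n → ℝ) :=
  fun i _ => Pi.single i (1 : ℝ)

section Frame

variable {n : ℕ} {U : Set (Fin n → ℝ)} {f g : (Fin n → ℝ) → ℝ}

lemma vf_eqOn (hU : IsOpen U) (X : (Fin n → ℝ) → (Fin n → ℝ)) (h : Set.EqOn f g U) :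
    Set.EqOn (vf X f) (vf X g) U := by
  intro x hx
  have : f =ᶠ[𝓝 x] g := by
    filter_upwards [hU.mem_nhds hx] with y hy using h hy
  simp only [vf, this.fderiv_eq]

lemma vfSeq_append (X : Fin n → (Fin n → ℝ) → (Fin n → ℝ)) (I J : List (Fin n))
    (f : (Fin n → ℝ) → ℝ) : vfSeq X (I ++ J) f = vfSeq X I (vfSeq X J f) := by
  induction I with
  | nil => rfl
  | cons i I ih => simp only [List.cons_append, vfSeq, ih]

lemma contDiffOn_vf (hU : IsOpen U) (hf : ContDiffOn ℝ (⊤ : ℕ∞) f U) (i : Fin n) :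
    ContDiffOn ℝ (⊤ : ℕ∞) (vf (coordFrame n i) f) U :=
  (hf.fderiv_of_isOpen hU (m := ((⊤ : ℕ∞) : WithTop ℕ∞)) (by simp)).clm_apply
    contDiffOn_const

lemma contDiffOn_vfSeq (hU : IsOpen U) (hf : ContDiffOn ℝ (⊤ : ℕ∞) f U) (I : List (Fin n)) :
    ContDiffOn ℝ (⊤ : ℕ∞) (vfSeq (coordFrame n) I f) U := by
  induction I with
  | nil => exact hf
  | cons i I ih => exact contDiffOn_vf hU ih i

lemma differentiableAt_of_contDiffOn (hU : IsOpen U) (hf : ContDiffOn ℝ (⊤ : ℕ∞) f U)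
    {x : Fin n → ℝ} (hx : x ∈ U) : DifferentiableAt ℝ f x :=
  (hf.contDiffAt (hU.mem_nhds hx)).differentiableAt (by simp)

lemma vf_comm (hU : IsOpen U) (hf : ContDiffOn ℝ (⊤ : ℕ∞) f U) (i j : Fin n) :
    Set.EqOn (vf (coordFrame n i) (vf (coordFrame n j) f))
      (vf (coordFrame n j) (vf (coordFrame n i) f)) U := by
  intro x hx
  have hx' := hf.contDiffAt (hU.mem_nhds hx)
  have hs : IsSymmSndFDerivAt ℝ f x := hx'.isSymmSndFDerivAt (by
    simp only [minSmoothness_of_isRCLikeNormedField]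
    exact WithTop.coe_le_coe.mpr (le_top : (2 : ℕ∞) ≤ ⊤))
  have hd : DifferentiableAt ℝ (fderiv ℝ f) x :=
    (hx'.fderiv_right (m := ((⊤ : ℕ∞) : WithTop ℕ∞)) (by simp)).differentiableAt (by simp)
  have key : ∀ u v : Fin n → ℝ,
      fderiv ℝ (fun y => fderiv ℝ f y v) x u = fderiv ℝ (fderiv ℝ f) x u v := by
    intro u v
    rw [fderiv_clm_apply hd (differentiableAt_const v)]
    simp
  exact (key _ _).trans ((hs _ _).trans (key _ _).symm)

lemma vfSeq_perm (hU : IsOpen U) (hf : ContDiffOn ℝ (⊤ : ℕ∞) f U) {I J : List (Fin n)}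
    (h : I.Perm J) : Set.EqOn (vfSeq (coordFrame n) I f) (vfSeq (coordFrame n) J f) U := by
  induction h with
  | nil => exact fun _ _ => rfl
  | cons i _ ih => exact vf_eqOn hU _ ih
  | swap i j I => exact vf_comm hU (contDiffOn_vfSeq hU hf I) j i
  | trans _ _ ih₁ ih₂ => exact ih₁.trans ih₂

lemma count_multiList (α : Fin n → ℕ) (i : Fin n) : (multiList α).count i = α i := by
  simp only [multiList, List.count_flatMap, Function.comp_def, List.count_replicate,
    beq_iff_eq]
  rw [← List.ofFn_eq_map, List.sum_ofFn]
  simp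

lemma perm_multiList (I : List (Fin n)) : I.Perm (multiList fun i => I.count i) := by
  rw [List.perm_iff_count]
  intro i
  rw [count_multiList]

lemma seqW_eq_wlen_count (w : Fin n → ℕ) (I : List (Fin n)) :
    seqW w I = wlen w fun i => I.count i := by
  simp only [seqW, wlen]
  rw [Finset.sum_list_map_count]
  simp only [smul_eq_mul, mul_comm (w _)]
  refine Finset.sum_subset (Finset.subset_univ _) fun i _ hi => ?_
  rw [List.count_eq_zero_of_not_mem (by simpa using hi), zero_mul]

lemma seqW_append (w : Fin n → ℕ) (I J : List (Fin n)) :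
    seqW w (I ++ J) = seqW w I + seqW w J := by
  simp [seqW]

lemma vfSeq_sub (hU : IsOpen U) (hf : ContDiffOn ℝ (⊤ : ℕ∞) f U)
    (hg : ContDiffOn ℝ (⊤ : ℕ∞) g U) (I : List (Fin n)) :
    Set.EqOn (vfSeq (coordFrame n) I fun x => f x - g x)
      (fun x => vfSeq (coordFrame n) I f x - vfSeq (coordFrame n) I g x) U := by
  induction I with
  | nil => exact fun _ _ => rfl
  | cons i I ih =>
    intro x hx
    have h := vf_eqOn hU (coordFrame n i) ih hx
    simp only [vfSeq]
    rw [h]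
    simp only [vf]
    rw [fderiv_fun_sub (differentiableAt_of_contDiffOn hU (contDiffOn_vfSeq hU hf I) hx)
      (differentiableAt_of_contDiffOn hU (contDiffOn_vfSeq hU hg I) hx)]
    rfl

lemma vfSeq_sum {ι : Type*} (s : Finset ι) (c : ι → ℝ) {F : ι → (Fin n → ℝ) → ℝ}
    (hF : ∀ a, ContDiff ℝ (⊤ : ℕ∞) (F a)) (I : List (Fin n)) :
    (vfSeq (coordFrame n) I fun x => ∑ a ∈ s, c a * F a x) =
      fun x => ∑ a ∈ s, c a * vfSeq (coordFrame n) I (F a) x := by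
  induction I with
  | nil => rfl
  | cons i I ih =>
    have hd : ∀ a x, DifferentiableAt ℝ (vfSeq (coordFrame n) I (F a)) x := fun a x =>
      differentiableAt_of_contDiffOn isOpen_univ
        (contDiffOn_vfSeq isOpen_univ (hF a).contDiffOn I) (Set.mem_univ x)
    funext x
    simp only [vfSeq, ih, vf]
    rw [fderiv_fun_sum fun a _ => (hd a x).const_mul (c a)]
    simp only [_root_.sum_apply]
    refine Finset.sum_congr rfl fun a _ => ?_
    rw [fderiv_const_mul (hd a x)]
    rfl

end Frame

section Monomials

variable {n : ℕ}

lemma contDiff_monom (α : Fin n → ℕ) : ContDiff ℝ (⊤ : ℕ∞) (monom α) := by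
  unfold monom
  fun_prop

lemma vf_monom (α : Fin n → ℕ) (i : Fin n) (x : Fin n → ℝ) :
    vf (coordFrame n i) (monom α) x =
      α i * monom (fun j => α j - if j = i then 1 else 0) x := by
  have h : HasFDerivAt (monom α) _ x :=
    HasFDerivAt.finsetProd (u := Finset.univ) fun j _ =>
      ((ContinuousLinearMap.proj (R := ℝ) (φ := fun _ : Fin n => ℝ) j).hasFDerivAt
        (x := x)).pow (α j)
  simp only [vf]
  rw [h.fderiv]
  simp only [_root_.sum_apply]
  rw [Finset.sum_eq_single i]
  · simp only [monom]
    rw [← Finset.mul_prod_erase _ _ (Finset.mem_univ i)]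
    have : ∏ j ∈ Finset.univ.erase i, x j ^ (α j - if j = i then 1 else 0) =
        ∏ j ∈ Finset.univ.erase i, x j ^ α j :=
      Finset.prod_congr rfl fun j hj => by simp [Finset.ne_of_mem_erase hj]
    rw [this]
    simp
    ring
  · intro j _ hj
    simp [hj]
  · simp

lemma vfSeq_monom (α : Fin n → ℕ) (I : List (Fin n)) (x : Fin n → ℝ) :
    vfSeq (coordFrame n) I (monom α) x =
      (∏ j, ((α j).descFactorial (I.count j) : ℝ)) * monom (fun j => α j - I.count j) x := by
  induction I generalizing x with
  | nil => simp [vfSeq]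
  | cons i I ih =>
    have hd : DifferentiableAt ℝ (monom fun j => α j - I.count j) x :=
      (contDiff_monom _).differentiable (by simp) x
    simp only [vfSeq]
    rw [show vfSeq (coordFrame n) I (monom α) = _ from funext ih]
    have h : vf (coordFrame n i) (fun x => (∏ j, ((α j).descFactorial (I.count j) : ℝ)) *
        monom (fun j => α j - I.count j) x) x = (∏ j, ((α j).descFactorial (I.count j) : ℝ)) *
        vf (coordFrame n i) (monom fun j => α j - I.count j) x := by
      simp only [vf]
      rw [fderiv_const_mul hd]
      rfl
    rw [h, vf_monom, ← mul_assoc]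
    congr 1
    · rw [← Finset.mul_prod_erase _ _ (Finset.mem_univ i),
        ← Finset.mul_prod_erase _ (fun j => ((α j).descFactorial ((i :: I).count j) : ℝ))
          (Finset.mem_univ i)]
      have : ∏ j ∈ Finset.univ.erase i, ((α j).descFactorial ((i :: I).count j) : ℝ) =
          ∏ j ∈ Finset.univ.erase i, ((α j).descFactorial (I.count j) : ℝ) :=
        Finset.prod_congr rfl fun j hj => by
          rw [List.count_cons_of_ne (Finset.ne_of_mem_erase hj).symm]
      rw [this, List.count_cons_self, Nat.descFactorial_succ]
      push_cast
      ring
    · congr 1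
      funext j
      rw [List.count_cons]
      by_cases hj : j = i
      · simp [hj, Nat.sub_sub]
      · simp [hj, Ne.symm hj]

lemma vfSeq_monom_zero (α : Fin n → ℕ) (I : List (Fin n)) :
    vfSeq (coordFrame n) I (monom α) 0 =
      if α = (fun i => I.count i) then ((∏ i, (α i).factorial : ℕ) : ℝ) else 0 := by
  rw [vfSeq_monom]
  split_ifs with h
  · have h' : ∀ j, I.count j = α j := fun j => (congrFun h j).symm
    simp [monom, h', Nat.descFactorial_self]
  · obtain ⟨i, hi⟩ := Function.ne_iff.mp h
    rcases lt_or_gt_of_ne hi with hlt | hgt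
    · rw [Finset.prod_eq_zero (Finset.mem_univ i), zero_mul]
      rw [Nat.descFactorial_eq_zero_iff_lt.mpr hlt, Nat.cast_zero]
    · have : α i - I.count i ≠ 0 := by omega
      exact mul_eq_zero_of_right _
        (Finset.prod_eq_zero (Finset.mem_univ i) (by simp [this]))

lemma monom_dil (w α : Fin n → ℕ) (t : ℝ) (x : Fin n → ℝ) :
    monom α (dil w t x) = t ^ wlen w α * monom α x := by
  simp only [monom, dil, wlen, mul_pow, ← pow_mul, Finset.prod_mul_distrib,
    Finset.prod_pow_eq_pow_sum]

lemma le_wlen {w : Fin n → ℕ} (hw : ∀ i, 0 < w i) (α : Fin n → ℕ) (i : Fin n) :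
    α i ≤ wlen w α :=
  (Nat.le_mul_of_pos_left _ (hw i)).trans
    (Finset.single_le_sum (f := fun i => w i * α i) (fun _ _ => Nat.zero_le _)
      (Finset.mem_univ i))

lemma mem_mIdx_of_wlen_lt {w : Fin n → ℕ} (hw : ∀ i, 0 < w i) {α : Fin n → ℕ} {B : ℕ}
    (h : wlen w α < B) : α ∈ mIdx n B := by
  simp only [mIdx, Fintype.mem_piFinset, Finset.mem_range]
  exact fun i => (le_wlen hw α i).trans_lt h

end Monomials

section WeightedTaylor

variable {n : ℕ} {U : Set (Fin n → ℝ)} {w : Fin n → ℕ} {f : (Fin n → ℝ) → ℝ}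

/-- The weighted Taylor polynomial of `f` at `0`, collecting the terms of weight `< N`. -/
noncomputable def weightedTaylor (w : Fin n → ℕ) (f : (Fin n → ℝ) → ℝ) (N : ℕ) :
    (Fin n → ℝ) → ℝ :=
  fun x => ∑ α ∈ (mIdx n N).filter (fun α => wlen w α < N), taylorCoeff α f * monom α x

lemma contDiff_weightedTaylor (w : Fin n → ℕ) (f : (Fin n → ℝ) → ℝ) (N : ℕ) :
    ContDiff ℝ (⊤ : ℕ∞) (weightedTaylor w f N) :=
  ContDiff.sum fun α _ => contDiff_const.mul (contDiff_monom α)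

lemma weightedTaylor_dil (hw : ∀ i, 0 < w i) (f : (Fin n → ℝ) → ℝ) (N : ℕ) (t : ℝ)
    (x : Fin n → ℝ) :
    weightedTaylor w f N (dil w t x) = ∑ ℓ ∈ Finset.range N, t ^ ℓ * homPart w f ℓ x := by
  rw [weightedTaylor, ← Finset.sum_fiberwise_of_maps_to (t := Finset.range N) (g := wlen w)
    (by simp)]
  refine Finset.sum_congr rfl fun ℓ hℓ => ?_
  rw [homPart, Finset.mul_sum]
  refine Finset.sum_congr ?_ ?_
  · ext α
    simp only [Finset.mem_filter, Finset.mem_range] at hℓ ⊢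
    constructor
    · rintro ⟨_, rfl⟩
      exact ⟨mem_mIdx_of_wlen_lt hw (Nat.lt_succ_self _), rfl⟩
    · rintro ⟨_, rfl⟩
      exact ⟨⟨mem_mIdx_of_wlen_lt hw hℓ, hℓ⟩, rfl⟩
  · intro α hα
    rw [monom_dil, (Finset.mem_filter.mp hα).2]
    ring

lemma vfSeq_sub_weightedTaylor_zero (hw : ∀ i, 0 < w i) (hU : IsOpen U)
    (h0 : (0 : Fin n → ℝ) ∈ U) (hf : ContDiffOn ℝ (⊤ : ℕ∞) f U) {N : ℕ} {I : List (Fin n)}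
    (hI : seqW w I < N) :
    vfSeq (coordFrame n) I (fun x => f x - weightedTaylor w f N x) 0 = 0 := by
  rw [vfSeq_sub hU hf (contDiff_weightedTaylor w f N).contDiffOn I h0]
  have hsum := congrFun (vfSeq_sum ((mIdx n N).filter (fun α => wlen w α < N))
    (fun α => taylorCoeff α f) contDiff_monom I) 0
  rw [seqW_eq_wlen_count] at hI
  simp only [vfSeq_monom_zero, mul_ite, mul_zero, Finset.sum_ite_eq', Finset.mem_filter,
    mem_mIdx_of_wlen_lt hw hI, hI, and_self, if_true] at hsum
  change _ - vfSeq (coordFrame n) I (fun x => ∑ α ∈ (mIdx n N).filter (fun α => wlen w α < N),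
    taylorCoeff α f * monom α x) 0 = 0
  rw [hsum, vfSeq_perm hU hf (perm_multiList I) h0, taylorCoeff, mul_right_comm,
    inv_mul_cancel₀ (by
      exact_mod_cast Finset.prod_ne_zero_iff.mpr fun i _ => Nat.factorial_ne_zero _), one_mul]
  exact sub_self _

end WeightedTaylor

section Dilations

variable {n : ℕ} {U : Set (Fin n → ℝ)} {w : Fin n → ℕ} {g : (Fin n → ℝ) → ℝ}

lemma continuous_dil (w : Fin n → ℕ) (t : ℝ) : Continuous (dil w t) := by
  unfold dil
  fun_prop

lemma dil_zero (hw : ∀ i, 0 < w i) (x : Fin n → ℝ) : dil w 0 x = 0 := by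
  funext i
  simp [dil, (hw i).ne']

lemma vfSeq_comp_dil (hU : IsOpen U) (hg : ContDiffOn ℝ (⊤ : ℕ∞) g U) (t : ℝ)
    (I : List (Fin n)) :
    Set.EqOn (vfSeq (coordFrame n) I fun x => g (dil w t x))
      (fun x => t ^ seqW w I * vfSeq (coordFrame n) I g (dil w t x)) (dil w t ⁻¹' U) := by
  induction I with
  | nil => intro x _; simp [vfSeq, seqW]
  | cons i I ih =>
    intro x hx
    have hV : IsOpen (dil w t ⁻¹' U) := hU.preimage (continuous_dil w t)
    simp only [vfSeq]
    rw [vf_eqOn hV _ ih hx]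
    have hdil : HasFDerivAt (dil w t) (ContinuousLinearMap.pi fun j =>
        t ^ w j • ContinuousLinearMap.proj (R := ℝ) (φ := fun _ : Fin n => ℝ) j) x :=
      (ContinuousLinearMap.pi fun j =>
        t ^ w j • ContinuousLinearMap.proj (R := ℝ) (φ := fun _ : Fin n => ℝ) j).hasFDerivAt
    have hgd := (differentiableAt_of_contDiffOn hU (contDiffOn_vfSeq hU hg I)
      (x := dil w t x) hx).hasFDerivAt
    have h := (hgd.comp x hdil).const_mul (t ^ seqW w I)
    simp only [vf]
    rw [show (fun x => t ^ seqW w I * vfSeq (coordFrame n) I g (dil w t x)) =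
      fun x => t ^ seqW w I * (vfSeq (coordFrame n) I g ∘ dil w t) x from rfl, h.fderiv]
    have hs : (fun j => t ^ w j * (Pi.single i (1 : ℝ) : Fin n → ℝ) j) =
        t ^ w i • (Pi.single i (1 : ℝ) : Fin n → ℝ) := by
      funext j
      by_cases hj : j = i
      · subst hj; simp
      · simp [hj]
    change t ^ seqW w I * fderiv ℝ (vfSeq (coordFrame n) I g) (dil w t x)
      (fun j => t ^ w j * (Pi.single i (1 : ℝ) : Fin n → ℝ) j) = _
    rw [hs, map_smul]
    simp only [seqW, List.map_cons, List.sum_cons, pow_add, smul_eq_mul]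
    ring

lemma hasDerivAt_comp_dil (hU : IsOpen U) (hg : ContDiffOn ℝ (⊤ : ℕ∞) g U) {s : ℝ}
    {x : Fin n → ℝ} (hx : dil w s x ∈ U) :
    HasDerivAt (fun s => g (dil w s x))
      (∑ i, w i * s ^ (w i - 1) * x i * vf (coordFrame n i) g (dil w s x)) s := by
  have hdil : HasDerivAt (fun s => dil w s x) (fun i => w i * s ^ (w i - 1) * x i) s :=
    hasDerivAt_pi.mpr fun i => (hasDerivAt_pow (w i) s).mul_const (x i)
  have h := (differentiableAt_of_contDiffOn hU hg hx).hasFDerivAt.comp_hasDerivAt s hdil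
  refine h.congr_deriv ?_
  rw [← Finset.univ_sum_single (fun i => (w i : ℝ) * s ^ (w i - 1) * x i), map_sum]
  refine Finset.sum_congr rfl fun i _ => ?_
  rw [← mul_one ((w i : ℝ) * s ^ (w i - 1) * x i), ← smul_eq_mul _ (1 : ℝ), Pi.single_smul,
    map_smul]
  simp [vf]

/-- A smooth function whose derivatives of weight `< k` vanish at `0` is `O(t^k)` along the
dilations, uniformly on bounded sets. -/
lemma exists_bound_comp_dil (hw : ∀ i, 0 < w i) (hU : IsOpen U)
    {B K : Set (Fin n → ℝ)} (hB : IsCompact B) (hBU : B ⊆ U) {M ε : ℝ} (hM : 0 ≤ M)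
    (hε : ε ≤ 1) (hK : ∀ x ∈ K, ∀ i, |x i| ≤ M)
    (hKB : ∀ t : ℝ, |t| ≤ ε → ∀ x ∈ K, dil w t x ∈ B) (k : ℕ)
    (hg : ContDiffOn ℝ (⊤ : ℕ∞) g U)
    (hv : ∀ I : List (Fin n), seqW w I < k → vfSeq (coordFrame n) I g 0 = 0) :
    ∃ C : ℝ, 0 ≤ C ∧ ∀ t : ℝ, |t| ≤ ε → ∀ x ∈ K, |g (dil w t x)| ≤ C * |t| ^ k := by
  induction k using Nat.strong_induction_on generalizing g with
  | _ k ih =>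
  rcases Nat.eq_zero_or_pos k with rfl | hk
  · obtain ⟨C, hC⟩ := hB.exists_bound_of_continuousOn (hg.continuousOn.mono hBU)
    refine ⟨max C 0, le_max_right _ _, fun t ht x hx => ?_⟩
    simpa using Or.inl (hC _ (hKB t ht x hx))
  have hpart : ∀ i, ∃ C : ℝ, 0 ≤ C ∧ ∀ t : ℝ, |t| ≤ ε → ∀ x ∈ K,
      |vf (coordFrame n i) g (dil w t x)| ≤ C * |t| ^ (k - w i) := by
    intro i
    have hi := hw i
    refine ih (k - w i) (by omega) (contDiffOn_vf hU hg i) fun I hI => ?_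
    have := hv (I ++ [i]) (by rw [seqW_append]; simp only [seqW, List.map_cons, List.map_nil,
      List.sum_cons, List.sum_nil] at hI ⊢; omega)
    rwa [vfSeq_append] at this
  choose C hC0 hC using hpart
  have hD0 : 0 ≤ ∑ i, w i * M * C i :=
    Finset.sum_nonneg fun i _ => mul_nonneg (mul_nonneg (Nat.cast_nonneg _) hM) (hC0 i)
  refine ⟨∑ i, w i * M * C i, hD0, fun t ht x hx => ?_⟩
  have hderiv : ∀ s ∈ Set.Icc (-|t|) |t|,
      ‖∑ i, w i * s ^ (w i - 1) * x i * vf (coordFrame n i) g (dil w s x)‖ ≤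
        (∑ i, w i * M * C i) * |t| ^ (k - 1) := by
    intro s hs
    have hst : |s| ≤ |t| := abs_le.mpr hs
    have hs1 : |s| ≤ 1 := hst.trans (ht.trans hε)
    refine (norm_sum_le _ _).trans ?_
    rw [Finset.sum_mul]
    refine Finset.sum_le_sum fun i _ => ?_
    have hi := hw i
    have hxM := hK x hx i
    have hCi := hC i s (hst.trans ht) x hx
    have hCi0 := hC0 i
    rw [Real.norm_eq_abs, abs_mul, abs_mul, abs_mul, abs_pow, Nat.abs_cast]
    calc (w i : ℝ) * |s| ^ (w i - 1) * |x i| * |vf (coordFrame n i) g (dil w s x)|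
        ≤ w i * |s| ^ (w i - 1) * M * (C i * |s| ^ (k - w i)) := by gcongr
      _ = w i * M * C i * |s| ^ (w i - 1 + (k - w i)) := by rw [pow_add]; ring
      _ ≤ w i * M * C i * |s| ^ (k - 1) :=
          mul_le_mul_of_nonneg_left
            (pow_le_pow_of_le_one (abs_nonneg s) hs1 (by omega)) (by positivity)
      _ ≤ w i * M * C i * |t| ^ (k - 1) := by gcongr
  have hmv := (convex_Icc (-|t|) |t|).norm_image_sub_le_of_norm_hasDerivWithin_le
    (fun s hs => (hasDerivAt_comp_dil hU hg
      (hBU (hKB s ((abs_le.mpr hs).trans ht) x hx))).hasDerivWithinAt) hderiv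
    (x := 0) (y := t) ⟨by simp, abs_nonneg t⟩ ⟨neg_abs_le t, le_abs_self t⟩
  have hg0 : g 0 = 0 := hv [] (by simpa [seqW] using hk)
  rw [dil_zero hw, hg0, sub_zero, sub_zero, Real.norm_eq_abs, Real.norm_eq_abs, mul_assoc,
    ← pow_succ, Nat.sub_add_cancel hk] at hmv
  exact hmv

end Dilations

/-- Asymptotic expansion of `f ∘ δ_t` in `C^∞(U)` as `t → 0`. -/
theorem anisotropic_expansion
    {n : ℕ} (hn : 0 < n) {w : Fin n → ℕ} (hw : IsWeight w)
    {U : Set (Fin n → ℝ)} (hU : IsOpen U) (h0 : (0 : Fin n → ℝ) ∈ U)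
    {f : (Fin n → ℝ) → ℝ} (hf : ContDiffOn ℝ (⊤ : ℕ∞) f U) (N : ℕ) :
    BigOC U
      (fun t x => f (dil w t x) -
        ∑ ℓ ∈ Finset.range N, t ^ ℓ * homPart w f ℓ x)
      (N : ℤ) := by
  intro K _ hKc β
  set R : (Fin n → ℝ) → ℝ := fun x => f x - weightedTaylor w f N x with hR
  have hRU : ContDiffOn ℝ (⊤ : ℕ∞) R U := hf.sub (contDiff_weightedTaylor w f N).contDiffOn
  obtain ⟨r, hr, hrU⟩ := Metric.nhds_basis_closedBall.mem_iff.mp (hU.mem_nhds h0)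
  obtain ⟨M, hM, hKM⟩ := hKc.isBounded.exists_pos_norm_le
  have hKi : ∀ x ∈ K, ∀ i, |x i| ≤ M := fun x hx i => (norm_le_pi_norm x i).trans (hKM x hx)
  set ε : ℝ := min 1 (r / M) with hε
  have hε0 : 0 < ε := lt_min one_pos (div_pos hr hM)
  have hKB : ∀ t : ℝ, |t| ≤ ε → ∀ x ∈ K, dil w t x ∈ Metric.closedBall 0 r := by
    intro t ht x hx
    rw [mem_closedBall_zero_iff, pi_norm_le_iff_of_nonneg hr.le]
    intro i
    rw [dil, norm_mul, norm_pow, Real.norm_eq_abs, Real.norm_eq_abs]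
    calc |t| ^ w i * |x i| ≤ |t| * M :=
          mul_le_mul (pow_le_of_le_one (abs_nonneg t) (ht.trans (min_le_left _ _))
            (hw.pos i).ne') (hKi x hx i) (abs_nonneg _) (abs_nonneg _)
      _ ≤ r / M * M := by gcongr; exact ht.trans (min_le_right _ _)
      _ = r := div_mul_cancel₀ r hM.ne'
  obtain ⟨C, hC0, hC⟩ := exists_bound_comp_dil hw.pos hU (isCompact_closedBall 0 r) hrU hM.le
    (min_le_left _ _) hKi hKB (N - seqW w (multiList β))
    (contDiffOn_vfSeq hU hRU (multiList β)) (by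
      intro I hI
      rw [← vfSeq_append]
      refine vfSeq_sub_weightedTaylor_zero hw.pos hU h0 hf ?_
      rw [seqW_append]
      omega)
  refine ⟨C, ?_⟩
  have hnhds : ∀ᶠ t in 𝓝[≠] (0 : ℝ), |t| ≤ ε := by
    filter_upwards [nhdsWithin_le_nhds (Metric.closedBall_mem_nhds (0 : ℝ) hε0)] with t ht
    simpa using ht
  filter_upwards [hnhds] with t ht x hx
  have hu : (fun x => f (dil w t x) - ∑ ℓ ∈ Finset.range N, t ^ ℓ * homPart w f ℓ x) =
      fun x => R (dil w t x) := by
    funext y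
    rw [hR, ← weightedTaylor_dil hw.pos]
  have hderiv := vfSeq_comp_dil (w := w) hU hRU t (multiList β) (hrU (hKB t ht x hx))
  rw [hu, pdPow, vfPow, zpow_natCast, hderiv, abs_mul, abs_pow]
  calc |t| ^ seqW w (multiList β) * |vfSeq (coordFrame n) (multiList β) R (dil w t x)|
      ≤ |t| ^ seqW w (multiList β) * (C * |t| ^ (N - seqW w (multiList β))) :=
        mul_le_mul_of_nonneg_left (hC t ht x hx) (by positivity)
    _ = C * |t| ^ (seqW w (multiList β) + (N - seqW w (multiList β))) := by
        rw [pow_add]; ring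
    _ ≤ C * |t| ^ N := mul_le_mul_of_nonneg_left
        (pow_le_pow_of_le_one (abs_nonneg t) (ht.trans (min_le_left _ _)) (by omega)) hC0

end Carnot
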